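/- Let ν > −1 and let (α_{ν,n})_{n≥1} be the strictly increasing enumeration of the positive zeros of the Dini function d_ν. Then ∑_{n≥1} 1/α_{ν,n}² = 3/(4(ν+1)). -/

import Mathlib

open Real Filter Set

/-- The Bessel function of the first kind of order `ν`, defined by its power series. -/
noncomputable def besselJ (ν x : ℝ) : ℝ :=
  ∑' n : ℕ, (-1 : ℝ) ^ n * x ^ (2 * (n : ℝ) + ν) /
    (2 ^ (2 * (n : ℝ) + ν) * (n.factorial : ℝ) * Real.Gamma ((n : ℝ) + ν + 1))

/-- The Dini function `d_ν(x) = (1-ν) J_ν(x) + x J_ν'(x) = J_ν(x) - x J_{ν+1}(x)`. -/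
noncomputable def dini (ν x : ℝ) : ℝ :=
  besselJ ν x - x * besselJ (ν + 1) x

section RealRoots

open Polynomial Topology

/-- Rolle's theorem on a half-line, for a function that vanishes at both ends. -/
theorem exists_hasDerivAt_eq_zero_Ioi {g g' : ℝ → ℝ} {a : ℝ} (hc : ContinuousOn g (Ici a))
    (hd : ∀ x, a < x → HasDerivAt g (g' x) x) (ha : g a = 0) (hlim : Tendsto g atTop (𝓝 0)) :
    ∃ x, a < x ∧ g' x = 0 := by
  have hpos : ∀ t ∈ Ioo (0 : ℝ) 1, 0 < 1 - t := fun t ht => by linarith [ht.2]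
  have h0 : Tendsto (fun t : ℝ => a + t / (1 - t)) (𝓝[>] 0) (𝓝[≥] a) := by
    apply tendsto_nhdsWithin_of_tendsto_nhds_of_eventually_within
    · have : ContinuousAt (fun t : ℝ => a + t / (1 - t)) 0 :=
        ContinuousAt.add continuousAt_const
          (ContinuousAt.div continuousAt_id (by fun_prop) (by norm_num))
      have h := this.tendsto
      simp only [sub_zero, div_one, add_zero] at h
      exact h.mono_left nhdsWithin_le_nhds
    · filter_upwards [Ioo_mem_nhdsGT (zero_lt_one' ℝ)] with t ht
      have := div_pos ht.1 (hpos t ht)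
      simp only [mem_Ici]; linarith
  have h1 : Tendsto (fun t : ℝ => a + t / (1 - t)) (𝓝[<] 1) atTop := by
    apply tendsto_atTop_add_const_left
    have h2 : Tendsto (fun t : ℝ => 1 - t) (𝓝[<] 1) (𝓝[>] 0) := by
      apply tendsto_nhdsWithin_of_tendsto_nhds_of_eventually_within
      · have : Continuous fun t : ℝ => 1 - t := by fun_prop
        have h := this.tendsto 1
        simp only [sub_self] at h
        exact h.mono_left nhdsWithin_le_nhds
      · filter_upwards [self_mem_nhdsWithin] with t ht
        simp only [mem_Iio, mem_Ioi] at *; linarith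
    have h3 : Tendsto (fun t : ℝ => t) (𝓝[<] 1) (𝓝 1) := nhdsWithin_le_nhds
    simpa [div_eq_mul_inv] using
      h3.pos_mul_atTop one_pos (tendsto_inv_nhdsGT_zero.comp h2)
  obtain ⟨t, ht, h⟩ := exists_hasDerivAt_eq_zero' (f := fun t => g (a + t / (1 - t)))
    (f' := fun t => g' (a + t / (1 - t)) * (1 / (1 - t) ^ 2)) (l := 0) one_pos
    (by
      have := (hc a self_mem_Ici).tendsto.comp h0
      rwa [ha] at this)
    (hlim.comp h1)
    (by
      intro t ht
      have hp := hpos t ht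
      have hq := div_pos ht.1 hp
      have h4 : HasDerivAt (fun t : ℝ => a + t / (1 - t)) (1 / (1 - t) ^ 2) t := by
        have := ((hasDerivAt_id t).div ((hasDerivAt_id t).const_sub 1) hp.ne').const_add a
        convert! this using 1
        simp
      exact (hd _ (by linarith)).comp t h4)
  refine ⟨_, ?_, (mul_eq_zero.1 h).resolve_right ?_⟩
  · have := div_pos ht.1 (hpos t ht)
    linarith
  · have := hpos t ht
    positivity

/-- Rolle's theorem, counting zeros on `[0, ∞)`. -/
theorem card_le_card_zeros_deriv_add_one {g g' : ℝ → ℝ} (hc : ContinuousOn g (Ici 0))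
    (hd : ∀ x, 0 < x → HasDerivAt g (g' x) x) {s t : Finset ℝ} (hs : ∀ r ∈ s, 0 ≤ r ∧ g r = 0)
    (ht : ∀ x, 0 < x → (∃ y ∈ s, x < y) → g' x = 0 → x ∈ t) : s.card ≤ t.card + 1 := by
  refine (Finset.card_le_sdiff_of_interleaved (t := t) fun x hx y hy hxy _ => ?_).trans
    (Nat.add_le_add_right (Finset.card_le_card Finset.sdiff_subset) 1)
  obtain ⟨z, hz, h⟩ := exists_hasDerivAt_eq_zero hxy
    (hc.mono fun w hw => (hs x hx).1.trans hw.1) ((hs x hx).2.trans (hs y hy).2.symm)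
    (f' := g') fun w hw => hd w ((hs x hx).1.trans_lt hw.1)
  exact ⟨z, ht z ((hs x hx).1.trans_lt hz.1) ⟨y, hy, hz.2⟩ h, hz.1, hz.2⟩

/-- Rolle's theorem, counting zeros on `[0, ∞)` of a function that vanishes at infinity. -/
theorem card_le_card_zeros_deriv {g g' : ℝ → ℝ} (hc : ContinuousOn g (Ici 0))
    (hd : ∀ x, 0 < x → HasDerivAt g (g' x) x) (hlim : Tendsto g atTop (𝓝 0)) {s t : Finset ℝ}
    (hs : ∀ r ∈ s, 0 ≤ r ∧ g r = 0) (ht : ∀ x, 0 < x → g' x = 0 → x ∈ t) :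
    s.card ≤ t.card := by
  rcases s.eq_empty_or_nonempty with rfl | hne
  · simp
  have hM := s.max'_mem hne
  obtain ⟨z, hz, h⟩ := exists_hasDerivAt_eq_zero_Ioi
    (hc.mono fun w hw => (hs _ hM).1.trans hw) (fun x hx => hd x ((hs _ hM).1.trans_lt hx))
    (hs _ hM).2 hlim
  have hzt : z ∈ t := ht z ((hs _ hM).1.trans_lt hz) h
  have := card_le_card_zeros_deriv_add_one hc hd hs (t := t.erase z) (by
    rintro x hx ⟨y, hy, hxy⟩ h
    refine Finset.mem_erase.2 ⟨?_, ht x hx h⟩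
    have := s.le_max' y hy
    intro hxz
    linarith)
  rwa [Finset.card_erase_add_one hzt] at this

/-- `p` has at least `n` distinct positive roots. -/
def HasPosRoots (n : ℕ) (p : ℝ[X]) : Prop :=
  ∃ s : Finset ℝ, n ≤ s.card ∧ ∀ r ∈ s, 0 < r ∧ p.eval r = 0

theorem hasPosRoots_of_card_le {p : ℝ[X]} (hp : p ≠ 0) {n : ℕ}
    (h : ∀ t : Finset ℝ, (∀ x, 0 < x → p.eval x = 0 → x ∈ t) → n ≤ t.card) : HasPosRoots n p := by
  classical
  refine ⟨p.roots.toFinset.filter (0 < ·), h _ fun x hx h => ?_, fun r hr => ?_⟩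
  · simpa [hp, hx] using h
  · simp only [Finset.mem_filter, Multiset.mem_toFinset, mem_roots hp, IsRoot.def] at hr
    exact hr.symm

/-- Multiplying by a positive power creates one more critical point. -/
theorem HasPosRoots.euler {n : ℕ} {p : ℝ[X]} (h : HasPosRoots n p) (h0 : p.eval 0 ≠ 0) {c : ℝ}
    (hc : 0 < c) : HasPosRoots n (C c * p + X * derivative p) := by
  obtain ⟨s, hn, hs⟩ := h
  refine hasPosRoots_of_card_le (fun h => ?_) fun t ht => ?_
  · have := congrArg (eval 0) h
    simp [hc.ne', h0] at this
  have hs0 : (0 : ℝ) ∉ s := fun h => (hs 0 h).1.ne' rfl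
  have := card_le_card_zeros_deriv_add_one (g := fun x => x ^ c * p.eval x)
    (g' := fun x => c * x ^ (c - 1) * p.eval x + x ^ c * (derivative p).eval x)
    (s := insert 0 s) (t := t)
    (((continuous_id.rpow_const fun _ => Or.inr hc.le).mul p.continuous).continuousOn)
    (fun x hx => (hasDerivAt_rpow_const (Or.inl hx.ne')).mul (p.hasDerivAt x))
    (by
      intro r hr
      rcases Finset.mem_insert.1 hr with rfl | hr
      · simp [zero_rpow hc.ne']
      · exact ⟨(hs r hr).1.le, by simp [(hs r hr).2]⟩)
    (by
      intro x hx _ h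
      refine ht x hx ?_
      have hx' : x ^ c = x ^ (c - 1) * x := by
        rw [← rpow_add_one hx.ne']; ring_nf
      have hx'' := (rpow_pos_of_pos hx (c - 1)).ne'
      have : x ^ (c - 1) * (c * p.eval x + x * (derivative p).eval x) = 0 := by
        rw [← h, hx']; ring
      simpa using (mul_eq_zero.1 this).resolve_left hx'')
  rw [Finset.card_insert_of_notMem hs0] at this
  omega

theorem tendsto_rpow_mul_exp_neg_mul_eval (p : ℝ[X]) (c : ℝ) :
    Tendsto (fun x => x ^ c * Real.exp (-x) * p.eval x) atTop (𝓝 0) := by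
  induction p using Polynomial.induction_on' with
  | add p q hp hq => simpa [mul_add] using hp.add hq
  | monomial n a =>
    have := (tendsto_rpow_mul_exp_neg_mul_atTop_nhds_zero (c + n) 1 one_pos).const_mul a
    rw [mul_zero] at this
    refine this.congr' ?_
    filter_upwards [eventually_gt_atTop 0] with x hx
    rw [eval_monomial, rpow_add_natCast hx.ne']
    ring_nf

theorem HasPosRoots.laguerre_step {n : ℕ} {p : ℝ[X]} (h : HasPosRoots n p) (h0 : p.eval 0 ≠ 0)
    {c : ℝ} (hc : 0 < c) : HasPosRoots (n + 1) ((C c - X) * p + X * derivative p) := by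
  obtain ⟨s, hn, hs⟩ := h
  refine hasPosRoots_of_card_le (fun h => ?_) fun t ht => ?_
  · have := congrArg (eval 0) h
    simp [hc.ne', h0] at this
  have hs0 : (0 : ℝ) ∉ s := fun h => (hs 0 h).1.ne' rfl
  have := card_le_card_zeros_deriv (g := fun x => x ^ c * Real.exp (-x) * p.eval x)
    (g' := fun x => (c * x ^ (c - 1) * Real.exp (-x) + x ^ c * (Real.exp (-x) * (-1))) * p.eval x
      + x ^ c * Real.exp (-x) * (derivative p).eval x)
    (s := insert 0 s) (t := t)
    ((((continuous_id.rpow_const fun _ => Or.inr hc.le).mul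
      (Real.continuous_exp.comp continuous_neg)).mul p.continuous).continuousOn)
    (fun x hx => ((hasDerivAt_rpow_const (Or.inl hx.ne')).mul
      (hasDerivAt_neg x).exp).mul (p.hasDerivAt x))
    (tendsto_rpow_mul_exp_neg_mul_eval p c)
    (by
      intro r hr
      rcases Finset.mem_insert.1 hr with rfl | hr
      · simp [zero_rpow hc.ne']
      · exact ⟨(hs r hr).1.le, by simp [(hs r hr).2]⟩)
    (by
      intro x hx h
      refine ht x hx ?_
      have hx' : x ^ c = x ^ (c - 1) * x := by
        rw [← rpow_add_one hx.ne']; ring_nf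
      have hx'' := (mul_pos (rpow_pos_of_pos hx (c - 1)) (Real.exp_pos (-x))).ne'
      have : (x ^ (c - 1) * Real.exp (-x)) *
          ((c - x) * p.eval x + x * (derivative p).eval x) = 0 := by
        rw [← h, hx']; ring
      simpa using (mul_eq_zero.1 this).resolve_left hx'')
  rw [Finset.card_insert_of_notMem hs0] at this
  omega

/-- A polynomial of degree at most `n` with value `1` at `0` and `n` distinct positive roots
is the product of the factors `1 - x / r`. -/
theorem HasPosRoots.exists_eq_prod {n : ℕ} {p : ℝ[X]} (h : HasPosRoots n p)
    (hdeg : p.natDegree ≤ n) (h0 : p.eval 0 = 1) :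
    ∃ s : Finset ℝ, (∀ r ∈ s, 0 < r) ∧ p = ∏ r ∈ s, (1 - C r⁻¹ * X) := by
  obtain ⟨s, hn, hs⟩ := h
  have hs0 : (0 : ℝ) ∉ s := fun h => (hs 0 h).1.ne' rfl
  refine ⟨s, fun r hr => (hs r hr).1, ?_⟩
  refine eq_of_degree_sub_lt_of_eval_finset_eq (insert 0 s) ?_ fun x hx => ?_
  · rw [Finset.card_insert_of_notMem hs0]
    refine lt_of_le_of_lt degree_le_natDegree (Nat.cast_lt.2 ?_)
    refine Nat.lt_succ_of_le ((natDegree_sub_le _ _).trans (max_le (hdeg.trans hn) ?_))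
    refine (natDegree_prod_le _ _).trans ((Finset.sum_le_card_nsmul _ _ 1 fun r _ => ?_).trans
      (by simp))
    refine (natDegree_sub_le _ _).trans (max_le (by simp) ?_)
    exact (natDegree_C_mul_le _ _).trans natDegree_X_le
  · rcases Finset.mem_insert.1 hx with rfl | hx
    · simp [h0, eval_prod]
    · rw [(hs x hx).2, eval_prod, Finset.prod_eq_zero hx]
      simp [(hs x hx).1.ne']

theorem coeff_one_prod_one_sub (s : Finset ℝ) :
    (∏ r ∈ s, (1 - C r⁻¹ * X)).coeff 1 = -∑ r ∈ s, 1 / r := by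
  classical
  suffices h : (∏ r ∈ s, (1 - C r⁻¹ * X)).coeff 0 = 1 ∧
      (∏ r ∈ s, (1 - C r⁻¹ * X)).coeff 1 = -∑ r ∈ s, 1 / r from h.2
  induction s using Finset.induction_on with
  | empty => simp [coeff_one]
  | insert a s ha ih =>
    rw [Finset.prod_insert ha, Finset.sum_insert ha, sub_mul, one_mul, mul_assoc]
    have h1 (p : ℝ[X]) : (X * p).coeff 1 = p.coeff 0 := coeff_X_mul p 0
    simp only [coeff_sub, coeff_C_mul, coeff_X_mul_zero, h1, ih.1, ih.2]
    constructor
    · simp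
    · ring

end RealRoots

section ZerosOfLimits

open Topology

theorem exists_ball_eventually_ne_zero {P : ℕ → ℝ → ℝ} {L x : ℝ}
    (h : Tendsto (fun q : ℕ × ℝ => P q.1 q.2) (atTop ×ˢ 𝓝 x) (𝓝 L)) (hL : L ≠ 0) :
    ∃ δ > 0, ∀ᶠ n in atTop, ∀ y ∈ Metric.ball x δ, P n y ≠ 0 := by
  obtain ⟨p, hp, q, hq, hpq⟩ := eventually_prod_iff.1 (h.eventually_ne hL)
  obtain ⟨δ, hδ, hball⟩ := Metric.eventually_nhds_iff_ball.1 hq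
  exact ⟨δ, hδ, hp.mono fun n hn y hy => hpq hn (hball y hy)⟩

/-- A differentiable function changes sign at a simple zero. -/
theorem exists_mul_neg_of_hasDerivAt {f : ℝ → ℝ} {f' a : ℝ} (hf : HasDerivAt f f' a)
    (ha : f a = 0) (hf' : f' ≠ 0) {U : Set ℝ} (hU : U ∈ 𝓝 a) :
    ∃ x y, uIcc x y ⊆ U ∧ f x * f y < 0 := by
  wlog h : 0 < f' generalizing f f'
  · obtain ⟨x, y, hxy, hneg⟩ := this hf.neg (by simp [ha]) (neg_ne_zero.2 hf')
      (neg_pos.2 (lt_of_le_of_ne (not_lt.1 h) hf'))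
    exact ⟨x, y, hxy, by simpa using hneg⟩
  have hsign := eventually_nhdsWithin_sign_eq_of_deriv_pos (by rwa [hf.deriv]) ha
  obtain ⟨δ, hδ, hball⟩ := Metric.eventually_nhds_iff_ball.1 (hsign.and hU)
  have hmem (t : ℝ) (ht : |t| < δ) : a + t ∈ Metric.ball a δ := by simpa using ht
  have hx : a + -(δ / 2) ∈ Metric.ball a δ := hmem _ (by rw [abs_neg, abs_of_pos] <;> linarith)
  have hy : a + δ / 2 ∈ Metric.ball a δ := hmem _ (by rw [abs_of_pos] <;> linarith)
  refine ⟨a + -(δ / 2), a + δ / 2, fun z hz => (hball z ?_).2, mul_neg_of_neg_of_pos ?_ ?_⟩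
  · exact (convex_ball a δ).ordConnected.uIcc_subset hx hy hz
  · rw [← sign_eq_neg_one_iff, (hball _ hx).1, sign_eq_neg_one_iff]; linarith
  · rw [← sign_eq_one_iff, (hball _ hy).1, sign_eq_one_iff]; linarith

theorem prod_one_sub_div_eq_zero_iff {s : Finset ℝ} (hs : ∀ r ∈ s, 0 < r) {x : ℝ} :
    ∏ r ∈ s, (1 - x / r) = 0 ↔ x ∈ s := by
  rw [Finset.prod_eq_zero_iff]
  constructor
  · rintro ⟨r, hr, h⟩
    have := (hs r hr).ne'
    have hx : x = r := by
      field_simp at h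
      linarith
    rwa [hx]
  · intro hx
    exact ⟨x, hx, by rw [div_self (hs x hx).ne', sub_self]⟩

/-- The large roots of a polynomial contribute little to the sum of the inverse roots if the
polynomial grows slowly on the negative axis. -/
theorem sum_inv_gt_le {s : Finset ℝ} (hs : ∀ r ∈ s, 0 < r) {R K ε : ℝ} (hR : 0 < R) (hK : 0 < K)
    (h : ∏ r ∈ s, (1 - -R / r) ≤ K * Real.exp (ε * R)) :
    ∑ r ∈ s with R < r, 1 / r ≤ 2 * (Real.log K / R + ε) := by
  have hfac : ∀ r ∈ s, 1 ≤ 1 - -R / r := fun r hr => by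
    have := div_pos hR (hs r hr)
    rw [neg_div]; linarith
  have h1 : Real.exp (∑ r ∈ s with R < r, R / r / 2) ≤ ∏ r ∈ s, (1 - -R / r) := by
    rw [Real.exp_sum]
    calc ∏ r ∈ s with R < r, Real.exp (R / r / 2) ≤ ∏ r ∈ s with R < r, (1 - -R / r) := by
          refine Finset.prod_le_prod (fun _ _ => (Real.exp_pos _).le) fun r hr => ?_
          obtain ⟨hr, hRr⟩ := Finset.mem_filter.1 hr
          have h0 := div_pos hR (hs r hr)
          have h1 : R / r < 1 := (div_lt_one (hs r hr)).2 hRr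
          have h2 := Real.add_one_le_exp (-(R / r / 2))
          have h3 : Real.exp (R / r / 2) * Real.exp (-(R / r / 2)) = 1 := by
            rw [← Real.exp_add, add_neg_cancel, Real.exp_zero]
          have h4 := Real.exp_pos (R / r / 2)
          rw [neg_div]
          generalize R / r = t at *
          generalize Real.exp (t / 2) = e at *
          have h5 : e * (1 - t / 2) ≤ 1 := by nlinarith
          nlinarith
      _ ≤ ∏ r ∈ s, (1 - -R / r) := by
          refine Finset.prod_le_prod_of_subset_of_one_le (Finset.filter_subset _ _)
            (fun r hr => zero_le_one.trans (hfac r (Finset.mem_filter.1 hr).1))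
            fun r hr _ => hfac r hr
  have h2 := (Real.log_le_log (Real.exp_pos _) (h1.trans h))
  rw [Real.log_exp, Real.log_mul hK.ne' (Real.exp_pos _).ne', Real.log_exp] at h2
  have h3 : ∑ r ∈ s with R < r, R / r / 2 = R / 2 * ∑ r ∈ s with R < r, 1 / r := by
    rw [Finset.mul_sum]
    exact Finset.sum_congr rfl fun r _ => by ring
  rw [h3] at h2
  have h4 : Real.log K / R + ε = (Real.log K + ε * R) / R := by field_simp
  rw [h4, ← mul_div_assoc, le_div_iff₀ hR]
  linarith

/-- A sequence of polynomials with positive simple roots, whose inverses have constant sum `S`,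
converging locally uniformly with its derivatives to a function of minimal exponential type
with simple positive zeros: the inverse zeros of the limit again have sum `S`. -/
theorem tsum_inv_zeros_eq_of_tendsto {P P' : ℕ → ℝ → ℝ} {F F' : ℝ → ℝ} {s : ℕ → Finset ℝ} {S : ℝ}
    (hpos : ∀ n, ∀ r ∈ s n, 0 < r) (hP : ∀ n x, P n x = ∏ r ∈ s n, (1 - x / r))
    (hS : ∀ n, ∑ r ∈ s n, 1 / r = S) (hdP : ∀ n x, HasDerivAt (P n) (P' n x) x)
    (hdF : ∀ x, HasDerivAt F (F' x) x)
    (hlim : ∀ x, Tendsto (fun q : ℕ × ℝ => P q.1 q.2) (atTop ×ˢ 𝓝 x) (𝓝 (F x)))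
    (hlim' : ∀ x, Tendsto (fun q : ℕ × ℝ => P' q.1 q.2) (atTop ×ˢ 𝓝 x) (𝓝 (F' x)))
    (hgrow : ∀ ε > 0, ∃ K > 0, ∀ n, ∀ R > 0, P n (-R) ≤ K * Real.exp (ε * R))
    (hF0 : F 0 ≠ 0) (hsimple : ∀ x, 0 < x → F x = 0 → F' x ≠ 0) :
    ∑' z : {x : ℝ | 0 < x ∧ F x = 0}, 1 / (z : ℝ) = S := by
  classical
  have hroot (n : ℕ) (x : ℝ) : P n x = 0 ↔ x ∈ s n := by
    rw [hP, prod_one_sub_div_eq_zero_iff (hpos n)]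
  have hinv (n : ℕ) : ∀ r ∈ s n, 0 ≤ 1 / r := fun r hr => (one_div_pos.2 (hpos n r hr)).le
  have hmem {a : ℝ} (ha : 0 < a) (hFa : F a = 0) {U : Set ℝ} (hU : U ∈ 𝓝 a) :
      ∀ᶠ n in atTop, ∃ r ∈ s n, r ∈ U := by
    obtain ⟨x, y, hxy, hneg⟩ := exists_mul_neg_of_hasDerivAt (hdF a) hFa (hsimple a ha hFa) hU
    have hpt (x : ℝ) : Tendsto (fun n => P n x) atTop (𝓝 (F x)) :=
      (hlim x).comp (tendsto_id.prodMk tendsto_const_nhds)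
    filter_upwards [((hpt x).mul (hpt y)).eventually_lt_const hneg] with n hn
    have h0 : (0 : ℝ) ∈ uIcc (P n x) (P n y) := by
      rw [mem_uIcc]
      rcases mul_neg_iff.1 hn with h | h
      · exact Or.inr ⟨h.2.le, h.1.le⟩
      · exact Or.inl ⟨h.1.le, h.2.le⟩
    obtain ⟨r, hr, h⟩ := intermediate_value_uIcc
      (fun z _ => (hdP n z).continuousAt.continuousWithinAt) h0
    exact ⟨r, (hroot n r).1 h, hxy hr⟩
  have hle (T : Finset ℝ) (hT : ∀ z ∈ T, 0 < z ∧ F z = 0) : ∑ z ∈ T, 1 / z ≤ S := by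
    have hc (c : ℝ) (hc : c < 1) : c * ∑ z ∈ T, 1 / z ≤ S := by
      obtain ⟨U, hU, hdisj⟩ := T.finite_toSet.t2_separation
      have hV : ∀ z ∈ T, U z ∩ {y | c * (1 / z) < 1 / y} ∈ 𝓝 z := fun z hz => by
        have hz0 := (hT z hz).1
        refine inter_mem ((hU z).2.mem_nhds (hU z).1) ?_
        have : ContinuousAt (fun y : ℝ => 1 / y) z :=
          continuousAt_const.div continuousAt_id hz0.ne'
        exact this.eventually_const_lt (mul_lt_of_lt_one_left (one_div_pos.2 hz0) hc)
      obtain ⟨n, hn⟩ := ((Finset.eventually_all T).2 fun z hz =>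
        hmem (hT z hz).1 (hT z hz).2 (hV z hz)).exists
      choose! r hr hrV using hn
      have hinj : Set.InjOn r T := fun x hx y hy hxy => by
        by_contra hne
        exact Set.disjoint_left.1 (hdisj hx hy hne) (hrV x hx).1 (hxy ▸ (hrV y hy).1)
      calc c * ∑ z ∈ T, 1 / z = ∑ z ∈ T, c * (1 / z) := Finset.mul_sum _ _ _
        _ ≤ ∑ z ∈ T, 1 / r z := Finset.sum_le_sum fun z hz => (hrV z hz).2.le
        _ = ∑ x ∈ T.image r, 1 / x := (Finset.sum_image hinj).symm
        _ ≤ ∑ x ∈ s n, 1 / x := Finset.sum_le_sum_of_subset_of_nonneg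
            (Finset.image_subset_iff.2 hr) fun x hx _ => hinv n x hx
        _ = S := hS n
    have hcont : Continuous fun c : ℝ => c * ∑ z ∈ T, 1 / z := by fun_prop
    have hl := (hcont.tendsto 1).mono_left (nhdsWithin_le_nhds (s := Iio 1))
    rw [one_mul] at hl
    exact le_of_tendsto hl (by filter_upwards [self_mem_nhdsWithin] with c h using hc c h)
  have hle' (T : Finset {x : ℝ | 0 < x ∧ F x = 0}) : ∑ z ∈ T, 1 / (z : ℝ) ≤ S := by
    refine (Finset.sum_map T (Function.Embedding.subtype _) fun z : ℝ => 1 / z).symm.trans_le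
      (hle _ fun z hz => ?_)
    obtain ⟨w, -, rfl⟩ := Finset.mem_map.1 hz
    exact w.2
  have hsum : Summable fun z : {x : ℝ | 0 < x ∧ F x = 0} => 1 / (z : ℝ) :=
    summable_of_sum_le (fun z => (one_div_pos.2 z.2.1).le) hle'
  refine le_antisymm (hsum.tsum_le_of_sum_le hle') ?_
  set A := ∑' z : {x : ℝ | 0 < x ∧ F x = 0}, 1 / (z : ℝ)
  have hlocal (η : ℝ) (hη : 0 < η) (x : ℝ) (hx : 0 ≤ x) : ∃ U ∈ 𝓝 x, ∀ᶠ n in atTop,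
      ∑ r ∈ s n with r ∈ U, 1 / r ≤ (1 + η) * if 0 < x ∧ F x = 0 then 1 / x else 0 := by
    by_cases hFx : F x = 0
    · have hx0 : 0 < x := lt_of_le_of_ne hx fun h => hF0 (h ▸ hFx)
      obtain ⟨δ, hδ, hball⟩ := exists_ball_eventually_ne_zero (hlim' x) (hsimple x hx0 hFx)
      have hcont : ContinuousAt (fun y : ℝ => 1 / y) x :=
        continuousAt_const.div continuousAt_id hx0.ne'
      refine ⟨Metric.ball x δ ∩ {y | 1 / y < (1 + η) * (1 / x)},
        inter_mem (Metric.ball_mem_nhds x hδ) (hcont.eventually_lt_const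
          (lt_mul_of_one_lt_left (one_div_pos.2 hx0) (by linarith))), ?_⟩
      filter_upwards [hball] with n hn
      rw [if_pos ⟨hx0, hFx⟩]
      have hno : ∀ r ∈ s n, ∀ r' ∈ s n, r ∈ Metric.ball x δ → r' ∈ Metric.ball x δ →
          ¬ r < r' := by
        intro r hr r' hr' hrb hrb' hlt
        obtain ⟨c, hc, h⟩ := exists_hasDerivAt_eq_zero hlt
          (fun z _ => (hdP n z).continuousAt.continuousWithinAt)
          (((hroot n r).2 hr).trans ((hroot n r').2 hr').symm) fun z _ => hdP n z
        exact hn c ((convex_ball x δ).ordConnected.out hrb hrb' (Ioo_subset_Icc_self hc)) h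
      have hw : 0 ≤ (1 + η) * (1 / x) := by positivity
      refine (Finset.sum_le_card_nsmul _ _ ((1 + η) * (1 / x)) fun r hr => by
        simp only [Finset.mem_filter] at hr
        exact hr.2.2.le).trans ?_
      rw [nsmul_eq_mul]
      refine mul_le_of_le_one_left hw (Nat.cast_le_one.2 ?_)
      · refine Finset.card_le_one.2 fun r hr r' hr' => ?_
        simp only [Finset.mem_filter] at hr hr'
        obtain ⟨hr, hrb, -⟩ := hr
        obtain ⟨hr', hrb', -⟩ := hr'
        exact le_antisymm (not_lt.1 (hno r' hr' r hr hrb' hrb))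
          (not_lt.1 (hno r hr r' hr' hrb hrb'))
    · obtain ⟨δ, hδ, hball⟩ := exists_ball_eventually_ne_zero (hlim x) hFx
      refine ⟨_, Metric.ball_mem_nhds x hδ, ?_⟩
      filter_upwards [hball] with n hn
      rw [if_neg fun h => hFx h.2, mul_zero, Finset.sum_filter]
      refine (Finset.sum_eq_zero fun r hr => if_neg fun h => hn r h ((hroot n r).2 hr)).le
  have hbound (η : ℝ) (hη : 0 < η) : S ≤ (1 + η) * A + 2 * η := by
    obtain ⟨K, hK, hPK⟩ := hgrow η hη
    have hR (R : ℝ) (hR : 0 < R) : S ≤ (1 + η) * A + 2 * (Real.log K / R + η) := by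
      choose! U hU hμ using hlocal η hη
      obtain ⟨t, ht, hcov⟩ := (isCompact_Icc (a := (0 : ℝ)) (b := R)).elim_nhds_subcover U
        fun x hx => hU x hx.1
      obtain ⟨n, hn⟩ := ((Finset.eventually_all t).2 fun x hx => hμ x (ht x hx).1).exists
      have htail := sum_inv_gt_le (hpos n) hR hK (hP n (-R) ▸ hPK n R hR)
      have hw : ∑ x ∈ t, (if 0 < x ∧ F x = 0 then 1 / x else 0) ≤ A := by
        let T : Finset {x : ℝ | 0 < x ∧ F x = 0} := t.subtype fun x => 0 < x ∧ F x = 0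
        rw [← Finset.sum_filter, ← Finset.sum_subtype_eq_sum_filter]
        exact hsum.sum_le_tsum T fun z _ => (one_div_pos.2 z.2.1).le
      have hhead : ∑ r ∈ s n with ¬ R < r, 1 / r ≤ (1 + η) * A :=
        calc ∑ r ∈ s n with ¬ R < r, 1 / r
            ≤ ∑ r ∈ s n, ∑ x ∈ t, (if r ∈ U x then 1 / r else 0) := by
              rw [Finset.sum_filter]
              refine Finset.sum_le_sum fun r hr => ?_
              have hterm : ∀ x ∈ t, 0 ≤ if r ∈ U x then 1 / r else 0 := fun x _ => by
                split_ifs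
                exacts [hinv n r hr, le_rfl]
              split_ifs with hrR
              · exact Finset.sum_nonneg hterm
              · obtain ⟨x, hx, hrx⟩ := mem_iUnion₂.1 (hcov ⟨(hpos n r hr).le, not_lt.1 hrR⟩)
                have := Finset.single_le_sum hterm hx
                rwa [if_pos hrx] at this
          _ = ∑ x ∈ t, ∑ r ∈ s n with r ∈ U x, 1 / r := by
              rw [Finset.sum_comm]
              simp_rw [Finset.sum_filter]
          _ ≤ ∑ x ∈ t, (1 + η) * (if 0 < x ∧ F x = 0 then 1 / x else 0) :=
              Finset.sum_le_sum hn
          _ ≤ (1 + η) * A := by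
              rw [← Finset.mul_sum]
              exact mul_le_mul_of_nonneg_left hw (by linarith)
      rw [← hS n, ← Finset.sum_filter_add_sum_filter_not (s n) (R < ·)]
      linarith
    have hl : Tendsto (fun R : ℝ => (1 + η) * A + 2 * (Real.log K / R + η)) atTop
        (𝓝 ((1 + η) * A + 2 * (0 + η))) :=
      (((tendsto_const_nhds.div_atTop tendsto_id).add_const η).const_mul 2).const_add _
    rw [zero_add] at hl
    exact ge_of_tendsto hl (by filter_upwards [eventually_gt_atTop 0] with R h using hR R h)
  have hcont : Continuous fun η : ℝ => (1 + η) * A + 2 * η := by fun_prop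
  have hl := (hcont.tendsto 0).mono_left (nhdsWithin_le_nhds (s := Ioi 0))
  rw [add_zero, one_mul, mul_zero, add_zero] at hl
  exact ge_of_tendsto hl (by filter_upwards [self_mem_nhdsWithin] with η h using hbound η h)

end ZerosOfLimits

section PowerSum

open Polynomial Topology

/-- The sum of the power series with coefficients `c`. -/
noncomputable def powerSum (c : ℕ → ℝ) (x : ℝ) : ℝ := ∑' k, c k * x ^ k

/-- The coefficients of a power series of minimal exponential type. -/
def MinimalType (c : ℕ → ℝ) : Prop :=
  ∀ ε > 0, ∃ K > 0, ∀ k, |c k| ≤ K * (ε ^ k / (k.factorial : ℝ))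

theorem MinimalType.mono {c d : ℕ → ℝ} (hc : MinimalType c) (h : ∀ k, |d k| ≤ |c k|) :
    MinimalType d := fun ε hε => by
  obtain ⟨K, hK, hcK⟩ := hc ε hε
  exact ⟨K, hK, fun k => (h k).trans (hcK k)⟩

theorem MinimalType.summable {c : ℕ → ℝ} (hc : MinimalType c) (x : ℝ) :
    Summable fun k => c k * x ^ k := by
  obtain ⟨K, -, hcK⟩ := hc 1 one_pos
  refine Summable.of_norm_bounded ((Real.summable_pow_div_factorial |x|).mul_left K) fun k => ?_
  rw [norm_mul, norm_pow, Real.norm_eq_abs, Real.norm_eq_abs]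
  calc |c k| * |x| ^ k ≤ K * (1 ^ k / (k.factorial : ℝ)) * |x| ^ k :=
        mul_le_mul_of_nonneg_right (hcK k) (by positivity)
    _ = K * (|x| ^ k / (k.factorial : ℝ)) := by rw [one_pow]; ring

theorem powerSum_le_mul_exp {c : ℕ → ℝ} {K ε : ℝ}
    (hcK : ∀ k, |c k| ≤ K * (ε ^ k / (k.factorial : ℝ))) {R : ℝ} (hR : 0 < R) :
    powerSum c (-R) ≤ K * Real.exp (ε * R) := by
  have hexp : HasSum (fun k : ℕ => K * ((ε * R) ^ k / (k.factorial : ℝ)))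
      (K * Real.exp (ε * R)) := by
    rw [Real.exp_eq_exp_ℝ]
    exact (NormedSpace.expSeries_div_hasSum_exp (ε * R)).mul_left K
  refine (le_abs_self _).trans
    (tsum_of_norm_bounded (f := fun k => c k * (-R) ^ k) hexp fun k => ?_)
  rw [norm_mul, norm_pow, norm_neg, Real.norm_eq_abs, Real.norm_eq_abs, abs_of_pos hR]
  calc |c k| * R ^ k ≤ K * (ε ^ k / (k.factorial : ℝ)) * R ^ k :=
        mul_le_mul_of_nonneg_right (hcK k) (by positivity)
    _ = K * ((ε * R) ^ k / (k.factorial : ℝ)) := by rw [mul_pow]; ring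

/-- The coefficients of the derivative of a power series. -/
def derivCoeff (c : ℕ → ℝ) (k : ℕ) : ℝ := (k + 1) * c (k + 1)

theorem MinimalType.deriv {c : ℕ → ℝ} (hc : MinimalType c) : MinimalType (derivCoeff c) := by
  intro ε hε
  obtain ⟨K, hK, hcK⟩ := hc ε hε
  refine ⟨K * ε, by positivity, fun k => ?_⟩
  rw [derivCoeff, abs_mul, abs_of_pos (by positivity : (0 : ℝ) < k + 1)]
  calc ((k : ℝ) + 1) * |c (k + 1)|
      ≤ (k + 1) * (K * (ε ^ (k + 1) / ((k + 1).factorial : ℝ))) :=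
        mul_le_mul_of_nonneg_left (hcK _) (by positivity)
    _ = K * ε * (ε ^ k / (k.factorial : ℝ)) := by
        rw [Nat.factorial_succ]; push_cast
        field_simp
        ring

theorem mul_powerSum_derivCoeff {c : ℕ → ℝ} (hc : MinimalType c) (x : ℝ) :
    x * powerSum (derivCoeff c) x = ∑' k : ℕ, (k : ℝ) * c k * x ^ k := by
  have h : Summable fun k : ℕ => ((k : ℝ) * c k) * x ^ k := by
    rw [← summable_nat_add_iff 1]
    refine ((hc.deriv.summable x).mul_left x).congr fun k => ?_
    rw [derivCoeff]; push_cast; ring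
  rw [h.tsum_eq_zero_add, powerSum, ← tsum_mul_left]
  simp only [CharP.cast_eq_zero, zero_mul, zero_add]
  refine tsum_congr fun k => ?_
  rw [derivCoeff]; push_cast; ring

theorem hasDerivAt_powerSum {c : ℕ → ℝ} (hc : MinimalType c) (x : ℝ) :
    HasDerivAt (powerSum c) (powerSum (derivCoeff c) x) x := by
  set R := |x| + 1 with hR
  have hsum : Summable fun k : ℕ => |c k * (k * R ^ (k - 1))| := by
    rw [← summable_nat_add_iff 1]
    refine (hc.deriv.summable R).abs.congr fun k => ?_
    rw [derivCoeff]; push_cast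
    congr 1; ring
  have hderiv := hasDerivAt_tsum_of_isPreconnected (g := fun k z => c k * z ^ k)
    (g' := fun k z => c k * (k * z ^ (k - 1))) hsum (Metric.isOpen_ball (x := (0 : ℝ)) (ε := R))
    (convex_ball _ _).isPreconnected (fun k y _ => (hasDerivAt_pow k y).const_mul (c k))
    (fun k y hy => by
      have hy : |y| ≤ |R| := by
        have := mem_ball_zero_iff.1 hy
        exact this.le.trans (le_abs_self R)
      rw [Real.norm_eq_abs, abs_mul, abs_mul, abs_mul, abs_mul, abs_pow, abs_pow]
      gcongr)
    (Metric.mem_ball_self (by positivity)) (hc.summable 0)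
    (y := x) (mem_ball_zero_iff.2 (by rw [Real.norm_eq_abs]; linarith))
  have hs : Summable fun k : ℕ => c k * (k * x ^ (k - 1)) := by
    rw [← summable_nat_add_iff 1]
    refine (hc.deriv.summable x).congr fun k => ?_
    rw [derivCoeff]; push_cast
    ring
  refine hderiv.congr_deriv ?_
  rw [hs.tsum_eq_zero_add, powerSum]
  simp only [CharP.cast_eq_zero, zero_mul, mul_zero, zero_add]
  refine tsum_congr fun k => ?_
  rw [derivCoeff]; push_cast
  ring

theorem tendsto_powerSum {c : ℕ → ℝ} {d : ℕ → ℕ → ℝ} (hc : MinimalType c)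
    (hd : ∀ n k, |d n k| ≤ |c k|) (hlim : ∀ k, Tendsto (fun n => d n k) atTop (𝓝 (c k))) (x : ℝ) :
    Tendsto (fun q : ℕ × ℝ => powerSum (d q.1) q.2) (atTop ×ˢ 𝓝 x) (𝓝 (powerSum c x)) := by
  refine tendsto_tsum_of_dominated_convergence (hc.summable (|x| + 1)).abs (fun k => ?_) ?_
  · exact ((hlim k).comp tendsto_fst).mul (((continuous_pow k).tendsto x).comp tendsto_snd)
  · have hball : ∀ᶠ y in 𝓝 x, |y| < |x| + 1 :=
      continuous_abs.continuousAt.eventually_lt_const (by linarith)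
    filter_upwards [tendsto_snd.eventually hball] with q hq k
    rw [Real.norm_eq_abs, abs_mul, abs_mul, abs_pow, abs_pow,
      abs_of_pos (by positivity : 0 < |x| + 1)]
    have := hd q.1 k
    gcongr

theorem powerSum_coeff (p : ℝ[X]) (x : ℝ) : powerSum p.coeff x = p.eval x := by
  rw [eval_eq_sum_range, powerSum]
  refine tsum_eq_sum fun k hk => ?_
  rw [coeff_eq_zero_of_natDegree_lt (by simpa [Nat.lt_succ_iff] using hk), zero_mul]

end PowerSum

section BesselCoefficients

open Polynomial Topology

/-- The coefficients of the entire function `f` with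
`J_ν(x) = x ^ ν / (2 ^ ν Γ(ν + 1)) * f(x²)`. -/
noncomputable def besselCoeff (ν : ℝ) (k : ℕ) : ℝ :=
  (-1 / 4) ^ k / ((k.factorial : ℝ) * (ascPochhammer ℝ k).eval (ν + 1))

/-- The coefficients of the entire function `F` with
`d_ν(x) = x ^ ν / (2 ^ ν Γ(ν + 1)) * F(x²)`. -/
noncomputable def diniCoeff (ν : ℝ) (k : ℕ) : ℝ := (2 * k + 1) * besselCoeff ν k

variable {ν : ℝ}

theorem summable_pow_div_ascPochhammer (hν : -1 < ν) {x : ℝ} (hx : 0 < x) :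
    Summable fun k : ℕ => x ^ k / (ascPochhammer ℝ k).eval (ν + 1) := by
  have hpos (k : ℕ) := ascPochhammer_pos k (ν + 1) (by linarith)
  refine summable_of_ratio_test_tendsto_lt_one zero_lt_one
    (Eventually.of_forall fun k => (div_pos (pow_pos hx k) (hpos k)).ne') ?_
  have hlim : Tendsto (fun k : ℕ => x / (ν + 1 + k)) atTop (𝓝 0) :=
    tendsto_const_nhds.div_atTop
      (tendsto_atTop_add_const_left _ _ tendsto_natCast_atTop_atTop)
  refine hlim.congr fun k => ?_
  have hk : 0 < ν + 1 + k := by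
    have := Nat.cast_nonneg (α := ℝ) k
    linarith
  have := hpos k
  rw [Real.norm_of_nonneg (div_pos (pow_pos hx _) (hpos _)).le,
    Real.norm_of_nonneg (div_pos (pow_pos hx _) (hpos _)).le, ascPochhammer_succ_eval]
  field_simp
  ring

theorem minimalType_diniCoeff (hν : -1 < ν) : MinimalType (diniCoeff ν) := by
  intro ε hε
  have hpos (k : ℕ) := ascPochhammer_pos k (ν + 1) (by linarith)
  have hx : 0 < 3 / (4 * ε) := by positivity
  have hs := summable_pow_div_ascPochhammer hν hx
  set K := ∑' k : ℕ, (3 / (4 * ε)) ^ k / (ascPochhammer ℝ k).eval (ν + 1)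
  have hle (k : ℕ) : (3 / (4 * ε)) ^ k / (ascPochhammer ℝ k).eval (ν + 1) ≤ K :=
    hs.le_tsum k fun j _ => (div_pos (pow_pos hx j) (hpos j)).le
  refine ⟨K, lt_of_lt_of_le (by simp) (hle 0), fun k => ?_⟩
  have hp := hpos k
  have h3 : (2 * k + 1 : ℝ) ≤ 3 ^ k := by
    have := one_add_mul_le_pow (a := (2 : ℝ)) (by norm_num) k
    norm_num at this
    linarith
  have habs : |diniCoeff ν k| =
      (2 * k + 1) * ((1 / 4) ^ k / ((k.factorial : ℝ) * (ascPochhammer ℝ k).eval (ν + 1))) := by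
    rw [diniCoeff, besselCoeff, abs_mul, abs_div, abs_pow, abs_of_pos (by positivity),
      abs_of_pos (by positivity : 0 < (k.factorial : ℝ) * (ascPochhammer ℝ k).eval (ν + 1))]
    norm_num [abs_div]
  rw [habs]
  calc _ ≤ 3 ^ k * ((1 / 4) ^ k / ((k.factorial : ℝ) * (ascPochhammer ℝ k).eval (ν + 1))) := by
        gcongr
    _ = (3 / (4 * ε)) ^ k / (ascPochhammer ℝ k).eval (ν + 1) * (ε ^ k / (k.factorial : ℝ)) := by
        rw [div_pow, div_pow, mul_pow]
        field_simp
        simp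
    _ ≤ K * (ε ^ k / (k.factorial : ℝ)) :=
        mul_le_mul_of_nonneg_right (hle k) (by positivity)

theorem minimalType_besselCoeff (hν : -1 < ν) : MinimalType (besselCoeff ν) :=
  (minimalType_diniCoeff hν).mono fun k => by
    rw [diniCoeff, abs_mul, abs_of_pos (by positivity : (0 : ℝ) < 2 * k + 1)]
    refine le_mul_of_one_le_left (abs_nonneg _) ?_
    have := Nat.cast_nonneg (α := ℝ) k
    linarith

theorem powerSum_diniCoeff (hν : -1 < ν) (x : ℝ) : powerSum (diniCoeff ν) x =
    powerSum (besselCoeff ν) x + 2 * (x * powerSum (derivCoeff (besselCoeff ν)) x) := by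
  have h := minimalType_besselCoeff hν
  have hs : Summable fun k : ℕ => (k : ℝ) * besselCoeff ν k * x ^ k := by
    refine ((((minimalType_diniCoeff hν).summable x).sub (h.summable x)).div_const 2).congr
      fun k => ?_
    rw [diniCoeff]; ring
  rw [mul_powerSum_derivCoeff h, powerSum, powerSum, ← tsum_mul_left,
    ← (h.summable x).tsum_add (hs.mul_left 2)]
  refine tsum_congr fun k => ?_
  rw [diniCoeff]; ring

theorem besselCoeff_succ (hν : -1 < ν) (k : ℕ) :
    (k + 1) * (ν + 1 + k) * besselCoeff ν (k + 1) = -besselCoeff ν k / 4 := by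
  have hp := ascPochhammer_pos k (ν + 1) (by linarith)
  have hk : 0 < ν + 1 + k := by
    have := Nat.cast_nonneg (α := ℝ) k
    linarith
  rw [besselCoeff, besselCoeff, ascPochhammer_succ_eval, Nat.factorial_succ, pow_succ]
  push_cast
  field_simp

/-- Bessel's equation in the variable `x²`. -/
theorem bessel_ode (hν : -1 < ν) (x : ℝ) :
    x * powerSum (derivCoeff (derivCoeff (besselCoeff ν))) x =
      -((ν + 1) * powerSum (derivCoeff (besselCoeff ν)) x) - powerSum (besselCoeff ν) x / 4 := by
  have h := minimalType_besselCoeff hν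
  rw [mul_powerSum_derivCoeff h.deriv, powerSum, powerSum, ← tsum_mul_left, ← tsum_div_const,
    ← tsum_neg, ← ((h.deriv.summable x).mul_left (ν + 1)).neg.tsum_sub ((h.summable x).div_const 4)]
  refine tsum_congr fun k => ?_
  rw [derivCoeff]
  linear_combination x ^ k * besselCoeff_succ hν k

theorem powerSum_zero (c : ℕ → ℝ) : powerSum c 0 = c 0 := by
  rw [powerSum, tsum_eq_single 0 fun k hk => by simp [hk]]
  simp

theorem powerSum_besselCoeff_zero : powerSum (besselCoeff ν) 0 = 1 := by
  simp [powerSum_zero, besselCoeff]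

theorem powerSum_diniCoeff_zero : powerSum (diniCoeff ν) 0 = 1 := by
  simp [powerSum_zero, diniCoeff, besselCoeff]

/-- The positive zeros of the Dini function are simple. -/
theorem powerSum_derivCoeff_diniCoeff_ne_zero (hν : -1 < ν) {a : ℝ} (ha : 0 < a)
    (hF : powerSum (diniCoeff ν) a = 0) : powerSum (derivCoeff (diniCoeff ν)) a ≠ 0 := by
  intro hF'
  have hb := minimalType_besselCoeff hν
  set f := powerSum (besselCoeff ν)
  set f₁ := powerSum (derivCoeff (besselCoeff ν))
  set f₂ := powerSum (derivCoeff (derivCoeff (besselCoeff ν)))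
  have hf (x : ℝ) : HasDerivAt f (f₁ x) x := hasDerivAt_powerSum hb x
  have hf₁ (x : ℝ) : HasDerivAt f₁ (f₂ x) x := hasDerivAt_powerSum hb.deriv x
  have hode (x : ℝ) : x * f₂ x = -((ν + 1) * f₁ x) - f x / 4 := bessel_ode hν x
  set Ψ : ℝ → ℝ := fun x => x ^ (ν + 1) * (x * f₁ x ^ 2 + ν * (f x * f₁ x) + f x ^ 2 / 4) with hΨ
  have hΨd (x : ℝ) (hx : 0 < x) : HasDerivAt Ψ (x ^ ν * (f x ^ 2 / 4)) x := by
    have h := (Real.hasDerivAt_rpow_const (p := ν + 1) (Or.inl hx.ne')).mul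
      ((((hasDerivAt_id x).mul ((hf₁ x).pow 2)).add (((hf x).mul (hf₁ x)).const_mul ν)).add
        (((hf x).pow 2).div_const 4))
    refine h.congr_deriv ?_
    simp only [add_sub_cancel_right, rpow_add_one hx.ne', id, Pi.mul_apply, Pi.add_apply,
      Pi.pow_apply, Nat.cast_ofNat]
    linear_combination x ^ ν * (2 * x * f₁ x + ν * f x) * hode x
  have hΨc : Continuous Ψ := by
    have h0 : Continuous f := continuous_iff_continuousAt.2 fun x => (hf x).continuousAt
    have h1 : Continuous f₁ := continuous_iff_continuousAt.2 fun x => (hf₁ x).continuousAt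
    exact (continuous_id.rpow_const fun _ => Or.inr (by linarith)).mul (by fun_prop)
  have hmono : MonotoneOn Ψ (Ici 0) := by
    refine monotoneOn_of_deriv_nonneg (convex_Ici 0) hΨc.continuousOn ?_ ?_ <;>
      rw [interior_Ici]
    · exact fun x hx => (hΨd x hx).differentiableAt.differentiableWithinAt
    · intro x hx
      rw [(hΨd x hx).deriv]
      have := rpow_nonneg (mem_Ioi.1 hx).le ν
      positivity
  have hΨ0 : Ψ 0 = 0 := by simp [hΨ, zero_rpow (by linarith : ν + 1 ≠ 0)]
  have hFd : HasDerivAt (powerSum (diniCoeff ν)) (f₁ a + 2 * (f₁ a + a * f₂ a)) a := by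
    have h := (hf a).add (((hasDerivAt_id a).mul (hf₁ a)).const_mul 2)
    rw [show powerSum (diniCoeff ν) = fun x => f x + 2 * (x * f₁ x) from
      funext (powerSum_diniCoeff hν)]
    exact h.congr_deriv (by simp)
  have h1 := hFd.unique (hasDerivAt_powerSum (minimalType_diniCoeff hν) a)
  rw [hF'] at h1
  rw [powerSum_diniCoeff hν] at hF
  have hΨa : Ψ a = 0 := by
    have hfa : f a = -2 * (a * f₁ a) := by linarith
    have h2 : (1 - 2 * ν + a) * f₁ a = 0 := by
      linear_combination h1 - 2 * hode a + 1 / 2 * hfa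
    rw [hΨ]
    simp only [hfa]
    linear_combination a ^ (ν + 1) * a * f₁ a * h2
  have hzero : ∀ x ∈ Ioo 0 a, f x = 0 := fun x hx => by
    have hev : Ψ =ᶠ[𝓝 x] fun _ => 0 := by
      filter_upwards [Ioo_mem_nhds hx.1 hx.2] with y hy
      refine le_antisymm ?_ ?_
      · rw [← hΨa]; exact hmono hy.1.le ha.le hy.2.le
      · rw [← hΨ0]; exact hmono self_mem_Ici hy.1.le hy.1.le
    have h3 := (hΨd x hx.1).unique ((hasDerivAt_const x 0).congr_of_eventuallyEq hev)
    have h4 := (rpow_pos_of_pos hx.1 ν).ne'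
    simpa [h4] using h3
  have hne : ∀ᶠ x in 𝓝[>] 0, f x ≠ 0 :=
    nhdsWithin_le_nhds ((hf 0).continuousAt.eventually_ne
      (powerSum_besselCoeff_zero.trans_ne one_ne_zero))
  obtain ⟨x, hx, hx'⟩ := (hne.and (Ioo_mem_nhdsGT ha)).exists
  exact hx (hzero x hx')

end BesselCoefficients

section Laguerre

open Polynomial Topology

theorem HasPosRoots.C_mul {n : ℕ} {p : ℝ[X]} (h : HasPosRoots n p) (a : ℝ) :
    HasPosRoots n (C a * p) := by
  obtain ⟨s, hn, hs⟩ := h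
  exact ⟨s, hn, fun r hr => ⟨(hs r hr).1, by simp [(hs r hr).2]⟩⟩

theorem HasPosRoots.comp_C_mul_X {n : ℕ} {p : ℝ[X]} (h : HasPosRoots n p) {a : ℝ} (ha : 0 < a) :
    HasPosRoots n (p.comp (C a * X)) := by
  classical
  obtain ⟨s, hn, hs⟩ := h
  refine ⟨s.image (· / a), ?_, fun r hr => ?_⟩
  · rwa [Finset.card_image_of_injective _ fun x y h => (div_left_inj' ha.ne').1 h]
  · obtain ⟨x, hx, rfl⟩ := Finset.mem_image.1 hr
    refine ⟨div_pos (hs x hx).1 ha, ?_⟩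
    simp [mul_div_cancel₀ x ha.ne', (hs x hx).2]

/-- The Laguerre polynomial of degree `n` and parameter `ν`, normalized to be `1` at `0`. -/
noncomputable def laguerrePoly (ν : ℝ) : ℕ → ℝ[X]
  | 0 => 1
  | n + 1 => C (n + 1 + ν)⁻¹ *
      ((C (n + 1 + ν) - X) * laguerrePoly ν n + X * derivative (laguerrePoly ν n))

variable {ν : ℝ}

theorem laguerrePoly_coeff (hν : -1 < ν) (n k : ℕ) : (laguerrePoly ν n).coeff k =
    n.choose k * (-1) ^ k / (ascPochhammer ℝ k).eval (ν + 1) := by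
  have hpos (k : ℕ) := ascPochhammer_pos k (ν + 1) (by linarith)
  induction n generalizing k with
  | zero => cases k <;> simp [laguerrePoly, coeff_one]
  | succ n ih =>
    have hc : (0 : ℝ) < n + 1 + ν := by
      have := Nat.cast_nonneg (α := ℝ) n
      linarith
    rw [laguerrePoly, coeff_C_mul, sub_mul, coeff_add, coeff_sub, coeff_C_mul]
    cases k with
    | zero => simp [ih, hc.ne']
    | succ k =>
      have hk : (0 : ℝ) < ν + 1 + k := by
        have := Nat.cast_nonneg (α := ℝ) k
        linarith
      have hp := hpos k
      have hchoose : ((k : ℝ) + 1) * n.choose (k + 1) = (n - k) * n.choose k := by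
        rcases le_or_gt k n with h | h
        · have := Nat.choose_succ_right_eq n k
          rw [← Nat.cast_sub h, mul_comm, mul_comm _ (n.choose k : ℝ)]
          exact_mod_cast this
        · rw [Nat.choose_eq_zero_of_lt h, Nat.choose_eq_zero_of_lt (h.trans k.lt_succ_self)]
          simp
      rw [coeff_X_mul, coeff_X_mul, coeff_derivative, ih, ih, ascPochhammer_succ_eval,
        Nat.choose_succ_succ, pow_succ]
      push_cast
      field_simp
      linear_combination (-1) * hchoose

theorem laguerrePoly_eval_zero (hν : -1 < ν) (n : ℕ) : (laguerrePoly ν n).eval 0 = 1 := by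
  simp [← coeff_zero_eq_eval_zero, laguerrePoly_coeff hν]

theorem hasPosRoots_laguerrePoly (hν : -1 < ν) (n : ℕ) : HasPosRoots n (laguerrePoly ν n) := by
  induction n with
  | zero => exact ⟨∅, by simp⟩
  | succ n ih =>
    have := Nat.cast_nonneg (α := ℝ) n
    exact (ih.laguerre_step (by simp [laguerrePoly_eval_zero hν]) (by linarith)).C_mul _

/-- Polynomials with positive roots that approximate the entire function with
coefficients `diniCoeff ν`. -/
noncomputable def diniPoly (ν : ℝ) (n : ℕ) : ℝ[X] :=
  (C 2 * (C (1 / 2) * laguerrePoly ν (n + 1) + X * derivative (laguerrePoly ν (n + 1)))).comp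
    (C (1 / (4 * ((n : ℝ) + 1))) * X)

theorem diniPoly_coeff (hν : -1 < ν) (n k : ℕ) : (diniPoly ν n).coeff k =
    diniCoeff ν k * (((n + 1).descFactorial k : ℝ) / ((n + 1 : ℕ) : ℝ) ^ k) := by
  have hp := ascPochhammer_pos k (ν + 1) (by linarith)
  have hX : (X * derivative (laguerrePoly ν (n + 1))).coeff k =
      k * (laguerrePoly ν (n + 1)).coeff k := by
    cases k with
    | zero => simp
    | succ k => rw [coeff_X_mul, coeff_derivative, mul_comm]; push_cast; ring
  rw [diniPoly, comp_C_mul_X_coeff, coeff_C_mul, coeff_add, coeff_C_mul, hX,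
    laguerrePoly_coeff hν, diniCoeff, besselCoeff, Nat.descFactorial_eq_factorial_mul_choose,
    div_pow, div_pow, mul_pow]
  push_cast
  field_simp
  rw [one_pow]
  ring

theorem diniPoly_exists_eq_prod (hν : -1 < ν) (n : ℕ) : ∃ s : Finset ℝ, (∀ r ∈ s, 0 < r) ∧
    (∀ x, (diniPoly ν n).eval x = ∏ r ∈ s, (1 - x / r)) ∧
      ∑ r ∈ s, 1 / r = 3 / (4 * (ν + 1)) := by
  have hroots : HasPosRoots (n + 1) (diniPoly ν n) :=
    (((hasPosRoots_laguerrePoly hν (n + 1)).euler (by simp [laguerrePoly_eval_zero hν])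
      one_half_pos).C_mul 2).comp_C_mul_X (a := 1 / (4 * ((n : ℝ) + 1))) (by positivity)
  obtain ⟨s, hs, hprod⟩ := hroots.exists_eq_prod
    (natDegree_le_iff_coeff_eq_zero.2 fun k hk => by
      rw [diniPoly_coeff hν, Nat.descFactorial_eq_zero_iff_lt.2 hk]; simp)
    (by simp [← coeff_zero_eq_eval_zero, diniPoly_coeff hν, diniCoeff, besselCoeff])
  refine ⟨s, hs, fun x => ?_, ?_⟩
  · rw [hprod, eval_prod]
    refine Finset.prod_congr rfl fun r _ => ?_
    simp [div_eq_inv_mul]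
  · have hsum : ∑ r ∈ s, 1 / r = -(diniPoly ν n).coeff 1 := by
      rw [hprod, coeff_one_prod_one_sub, neg_neg]
    have hν' : ν + 1 ≠ 0 := by linarith
    have hn : (n : ℝ) + 1 ≠ 0 := by positivity
    rw [hsum, diniPoly_coeff hν, diniCoeff, besselCoeff]
    simp
    field_simp
    norm_num

theorem abs_diniPoly_coeff_le (hν : -1 < ν) (n k : ℕ) :
    |(diniPoly ν n).coeff k| ≤ |diniCoeff ν k| := by
  rw [diniPoly_coeff hν, abs_mul]
  refine mul_le_of_le_one_right (abs_nonneg _) ?_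
  rw [abs_of_nonneg (by positivity)]
  refine div_le_one_of_le₀ ?_ (by positivity)
  exact_mod_cast Nat.descFactorial_le_pow (n + 1) k

theorem tendsto_diniPoly_coeff (hν : -1 < ν) (k : ℕ) :
    Tendsto (fun n => (diniPoly ν n).coeff k) atTop (𝓝 (diniCoeff ν k)) := by
  have h : Tendsto (fun n : ℕ => (n.descFactorial k : ℝ) / (n : ℝ) ^ k) atTop (𝓝 1) :=
    (Asymptotics.isEquivalent_iff_tendsto_one (by
      filter_upwards [eventually_ne_atTop 0] with n hn
      have : (n : ℝ) ≠ 0 := Nat.cast_ne_zero.2 hn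
      positivity)).1 (isEquivalent_descFactorial k)
  have := (h.comp (tendsto_add_atTop_nat 1)).const_mul (diniCoeff ν k)
  rw [mul_one] at this
  exact this.congr fun n => (diniPoly_coeff hν n k).symm

theorem tsum_inv_zeros_powerSum_diniCoeff (hν : -1 < ν) :
    ∑' z : {x : ℝ | 0 < x ∧ powerSum (diniCoeff ν) x = 0}, 1 / (z : ℝ) = 3 / (4 * (ν + 1)) := by
  have hc := minimalType_diniCoeff hν
  have hle := abs_diniPoly_coeff_le hν
  have hlim := tendsto_diniPoly_coeff hν
  choose s hs hprod hsum using diniPoly_exists_eq_prod hν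
  refine tsum_inv_zeros_eq_of_tendsto (P := fun n => powerSum (diniPoly ν n).coeff)
    (P' := fun n => powerSum (derivCoeff (diniPoly ν n).coeff))
    (F' := powerSum (derivCoeff (diniCoeff ν))) hs
    (fun n x => (powerSum_coeff _ x).trans (hprod n x)) hsum
    (fun n x => hasDerivAt_powerSum (hc.mono (hle n)) x) (fun x => hasDerivAt_powerSum hc x)
    (tendsto_powerSum hc hle hlim)
    (tendsto_powerSum hc.deriv (fun n k => ?_) fun k => (hlim (k + 1)).const_mul _) ?_
    (powerSum_diniCoeff_zero.trans_ne one_ne_zero)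
    fun x hx => powerSum_derivCoeff_diniCoeff_ne_zero hν hx
  · simp only [derivCoeff, abs_mul]
    exact mul_le_mul_of_nonneg_left (hle n (k + 1)) (abs_nonneg _)
  · intro ε hε
    obtain ⟨K, hK, hcK⟩ := hc ε hε
    exact ⟨K, hK, fun n R hR => powerSum_le_mul_exp (fun k => (hle n k).trans (hcK k)) hR⟩

end Laguerre

section Dini

theorem besselJ_eq {ν x : ℝ} (hν : -1 < ν) (hx : 0 < x) :
    besselJ ν x = x ^ ν / (2 ^ ν * Real.Gamma (ν + 1)) * powerSum (besselCoeff ν) (x ^ 2) := by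
  have hG := Real.Gamma_pos_of_pos (by linarith : 0 < ν + 1)
  have hΓ (n : ℕ) : Real.Gamma (n + ν + 1) =
      (ascPochhammer ℝ n).eval (ν + 1) * Real.Gamma (ν + 1) := by
    induction n with
    | zero => simp
    | succ n ih =>
      have hn : (n : ℝ) + ν + 1 ≠ 0 := by
        have := Nat.cast_nonneg (α := ℝ) n
        linarith
      rw [show ((n + 1 : ℕ) : ℝ) + ν + 1 = n + ν + 1 + 1 by push_cast; ring,
        Real.Gamma_add_one hn, ih, ascPochhammer_succ_eval]
      ring
  rw [besselJ, powerSum, ← tsum_mul_left]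
  refine tsum_congr fun n => ?_
  have hp := ascPochhammer_pos n (ν + 1) (by linarith)
  have hpow {y : ℝ} (hy : 0 < y) : y ^ (2 * (n : ℝ) + ν) = (y ^ 2) ^ n * y ^ ν := by
    rw [rpow_add hy, ← pow_mul, ← rpow_natCast]
    push_cast; rfl
  rw [hpow hx, hpow two_pos, hΓ, besselCoeff, div_pow]
  have h2 := rpow_pos_of_pos two_pos ν
  norm_num
  field_simp

theorem derivCoeff_besselCoeff {ν : ℝ} (hν : -1 < ν) (k : ℕ) :
    derivCoeff (besselCoeff ν) k = -1 / (4 * (ν + 1)) * besselCoeff (ν + 1) k := by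
  have hp := ascPochhammer_pos k (ν + 1 + 1) (by linarith)
  have hν' : 0 < ν + 1 := by linarith
  rw [derivCoeff, besselCoeff, besselCoeff, ascPochhammer_succ_left, Nat.factorial_succ, pow_succ]
  simp only [Polynomial.eval_mul, Polynomial.eval_X, Polynomial.eval_comp, Polynomial.eval_add,
    Polynomial.eval_one]
  push_cast
  field_simp

theorem dini_eq {ν x : ℝ} (hν : -1 < ν) (hx : 0 < x) :
    dini ν x = x ^ ν / (2 ^ ν * Real.Gamma (ν + 1)) * powerSum (diniCoeff ν) (x ^ 2) := by
  have hν' : 0 < ν + 1 := by linarith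
  have hG := Real.Gamma_pos_of_pos hν'
  have hd : powerSum (derivCoeff (besselCoeff ν)) (x ^ 2) =
      -1 / (4 * (ν + 1)) * powerSum (besselCoeff (ν + 1)) (x ^ 2) := by
    rw [powerSum, powerSum, ← tsum_mul_left]
    exact tsum_congr fun k => by rw [derivCoeff_besselCoeff hν, mul_assoc]
  have h2 := rpow_pos_of_pos two_pos ν
  rw [dini, besselJ_eq hν hx, besselJ_eq (by linarith : -1 < ν + 1) hx, powerSum_diniCoeff hν, hd,
    Real.Gamma_add_one hν'.ne', rpow_add_one hx.ne', rpow_add_one two_ne_zero]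
  field_simp
  ring

theorem dini_eq_zero_iff {ν x : ℝ} (hν : -1 < ν) (hx : 0 < x) :
    dini ν x = 0 ↔ powerSum (diniCoeff ν) (x ^ 2) = 0 := by
  have hG := Real.Gamma_pos_of_pos (by linarith : 0 < ν + 1)
  rw [dini_eq hν hx, mul_eq_zero_iff_left (by positivity)]

end Dini

/-- Let `ν > -1` and let `α 1 < α 2 < ⋯` be the strictly increasing
enumeration of the positive zeros of the Dini function `d_ν` (with `α 0 = 0`). Then
`∑_{n ≥ 1} 1 / α_n² = 3 / (4 (ν + 1))`. -/
theorem dini_zeros_sum_inv_sq (ν : ℝ) (hν : -1 < ν) (α : ℕ → ℝ)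
    (hα0 : α 0 = 0) (hmono : StrictMono α)
    (hzeros : ∀ x : ℝ, (0 < x ∧ dini ν x = 0) ↔ ∃ n, 1 ≤ n ∧ α n = x) :
    ∑' n : ℕ, 1 / (α (n + 1)) ^ 2 = 3 / (4 * (ν + 1)) := by
  have hpos (n : ℕ) : 0 < α (n + 1) := hα0 ▸ hmono n.succ_pos
  have hinj : Function.Injective fun n => α (n + 1) ^ 2 := fun m n h =>
    Nat.succ_injective (hmono.injective ((pow_left_inj₀ (hpos m).le (hpos n).le two_ne_zero).1 h))
  have hset : {x : ℝ | 0 < x ∧ powerSum (diniCoeff ν) x = 0} = range fun n => α (n + 1) ^ 2 := by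
    ext w
    constructor
    · rintro ⟨hw, hFw⟩
      have hsq := Real.sqrt_pos.2 hw
      rw [← Real.sq_sqrt hw.le, ← dini_eq_zero_iff hν hsq] at hFw
      obtain ⟨n, hn, h⟩ := (hzeros _).1 ⟨hsq, hFw⟩
      refine ⟨n - 1, ?_⟩
      simp only [Nat.sub_add_cancel hn, h, Real.sq_sqrt hw.le]
    · rintro ⟨n, rfl⟩
      obtain ⟨h, h0⟩ := (hzeros _).2 ⟨n + 1, by omega, rfl⟩
      exact ⟨pow_pos h 2, (dini_eq_zero_iff hν h).1 h0⟩
  rw [← tsum_inv_zeros_powerSum_diniCoeff hν, hset]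
  exact (tsum_range (fun x : ℝ => 1 / x) hinj).symm
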